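/- There is no non-zero Sp-invariant linear form on the space N₁ of normal tensors of order 1: if φ : N₁ → ℝ is a linear map such that φ(M·T) = φ(T) for every M ∈ Sp(2n,ℝ) and every T ∈ N₁, where (M·T)(x₁,x₂,x₃,x₄) = T(M⁻¹x₁, M⁻¹x₂, M⁻¹x₃, M⁻¹x₄), then φ = 0. (This is the key computation behind the statement that there are no non-constant homogeneous natural functions of Fedosov structures of weight −2.) -/

import Mathlib

/-- `V n = ℝ^{2n}`, realized with index set `Fin n ⊕ Fin n` (as in Mathlib's
`Matrix.J` and `Matrix.symplecticGroup`). -/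
abbrev V (n : ℕ) : Type := (Fin n ⊕ Fin n) → ℝ

/-- The space of 4-multilinear forms on `V n`. -/
abbrev M4 (n : ℕ) := MultilinearMap ℝ (fun _ : Fin 4 => V n) ℝ

/-- Membership in `N₁`, the space of normal tensors of order 1. -/
def IsN1 (n : ℕ) (T : M4 n) : Prop :=
  (∀ x y z w : V n, T ![x, y, z, w] = T ![x, z, y, w]) ∧
  (∀ (x : V n) (u : Fin 3 → V n),
    ∑ σ : Equiv.Perm (Fin 3), T ![x, u (σ 0), u (σ 1), u (σ 2)] = 0) ∧
  (∀ x y z w : V n,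
    T ![x, z, y, w] - T ![y, z, x, w] = T ![x, w, y, z] - T ![y, w, x, z])

/-- The action of a matrix `M` on a 4-multilinear form :
`(M·T)(x₁,x₂,x₃,x₄) = T(M⁻¹x₁, M⁻¹x₂, M⁻¹x₃, M⁻¹x₄)`. -/
noncomputable def matAct (n : ℕ) (M : Matrix (Fin n ⊕ Fin n) (Fin n ⊕ Fin n) ℝ)
    (T : M4 n) : M4 n :=
  T.compLinearMap fun _ => (M⁻¹).mulVecLin

open Matrix

/-- A sum over the permutations of `Fin 3`, written out. -/
theorem sum_perm_fin_three {R : Type*} [AddCommMonoid R] (g : Fin 3 → Fin 3 → Fin 3 → R) :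
    ∑ σ : Equiv.Perm (Fin 3), g (σ 0) (σ 1) (σ 2) =
      g 0 1 2 + g 0 2 1 + g 1 0 2 + g 1 2 0 + g 2 0 1 + g 2 1 0 := by
  have h : (Finset.univ : Finset (Equiv.Perm (Fin 3))) =
      {1, Equiv.swap 1 2, Equiv.swap 0 1, Equiv.swap 0 1 * Equiv.swap 1 2,
        Equiv.swap 0 2 * Equiv.swap 1 2, Equiv.swap 0 2} := by decide
  rw [h, Finset.sum_insert (by decide), Finset.sum_insert (by decide),
    Finset.sum_insert (by decide), Finset.sum_insert (by decide),
    Finset.sum_insert (by decide), Finset.sum_singleton]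
  simp only [← add_assoc]
  congr 1

/-- The decomposable form `(x, y, z, w) ↦ (a ⬝ x) (b ⬝ y) (c ⬝ z) (d ⬝ w)`. -/
noncomputable def pureForm {n : ℕ} (a b c d : V n) : M4 n :=
  (MultilinearMap.mkPiAlgebra ℝ (Fin 4) ℝ).compLinearMap
    fun i => dotProductBilin ℝ ℝ (![a, b, c, d] i)

theorem pureForm_apply {n : ℕ} (a b c d : V n) (v : Fin 4 → V n) :
    pureForm a b c d v = (a ⬝ᵥ v 0) * (b ⬝ᵥ v 1) * (c ⬝ᵥ v 2) * (d ⬝ᵥ v 3) := by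
  simp [pureForm, Fin.prod_univ_four]

/-- The normal tensor of order 1 attached to `a ⊗ a ⊗ a ⊗ b`. -/
noncomputable def normalForm {n : ℕ} (a b : V n) : M4 n :=
  (2 : ℝ) • pureForm a a a b - pureForm a b a a - pureForm a a b a

theorem normalForm_apply {n : ℕ} (a b : V n) (v : Fin 4 → V n) :
    normalForm a b v = (a ⬝ᵥ v 0) * (2 * (a ⬝ᵥ v 1) * (a ⬝ᵥ v 2) * (b ⬝ᵥ v 3) -
      (b ⬝ᵥ v 1) * (a ⬝ᵥ v 2) * (a ⬝ᵥ v 3) - (a ⬝ᵥ v 1) * (b ⬝ᵥ v 2) * (a ⬝ᵥ v 3)) := by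
  simp only [normalForm, _root_.sub_apply, _root_.smul_apply, pureForm_apply,
    smul_eq_mul]
  ring

theorem isN1_normalForm {n : ℕ} (a b : V n) : IsN1 n (normalForm a b) := by
  refine ⟨fun x y z w => ?_, fun x u => ?_, fun x y z w => ?_⟩
  · simp only [normalForm_apply, cons_val]
    ring
  · rw [sum_perm_fin_three fun i j k => normalForm a b ![x, u i, u j, u k]]
    simp [normalForm_apply]
    ring
  · simp [normalForm_apply]
    ring

theorem IsN1.add {n : ℕ} {T S : M4 n} (hT : IsN1 n T) (hS : IsN1 n S) : IsN1 n (T + S) := by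
  refine ⟨fun x y z w => ?_, fun x u => ?_, fun x y z w => ?_⟩
  · simp only [_root_.add_apply, hT.1 x y z w, hS.1 x y z w]
  · simp only [_root_.add_apply, Finset.sum_add_distrib, hT.2.1, hS.2.1, add_zero]
  · simp only [_root_.add_apply]
    linear_combination hT.2.2 x y z w + hS.2.2 x y z w

theorem IsN1.smul {n : ℕ} (c : ℝ) {T : M4 n} (hT : IsN1 n T) : IsN1 n (c • T) := by
  refine ⟨fun x y z w => ?_, fun x u => ?_, fun x y z w => ?_⟩
  · simp only [_root_.smul_apply, hT.1 x y z w]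
  · simp only [_root_.smul_apply, ← Finset.smul_sum, hT.2.1, smul_zero]
  · simp only [_root_.smul_apply, smul_eq_mul]
    linear_combination c * hT.2.2 x y z w

theorem normalForm_add_right {n : ℕ} (a b c : V n) :
    normalForm a (b + c) = normalForm a b + normalForm a c := by
  refine MultilinearMap.ext fun v => ?_
  simp only [_root_.add_apply, normalForm_apply, add_dotProduct]
  ring

theorem matAct_normalForm {n : ℕ} (M : Matrix (Fin n ⊕ Fin n) (Fin n ⊕ Fin n) ℝ) (a b : V n) :
    matAct n M (normalForm a b) = normalForm (a ᵥ* M⁻¹) (b ᵥ* M⁻¹) := by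
  refine MultilinearMap.ext fun v => ?_
  simp [matAct, normalForm_apply, dotProduct_mulVec]

theorem normalForm_smul_smul {n : ℕ} (s t : ℝ) (a b : V n) :
    normalForm (s • a) (t • b) = (s ^ 3 * t) • normalForm a b := by
  refine MultilinearMap.ext fun v => ?_
  simp only [_root_.smul_apply, normalForm_apply, smul_dotProduct, smul_eq_mul]
  ring

theorem dotProduct_J_mulVec_swap {n : ℕ} (a b : V n) :
    a ⬝ᵥ (J (Fin n) ℝ *ᵥ b) = -(b ⬝ᵥ (J (Fin n) ℝ *ᵥ a)) := by
  rw [dotProduct_mulVec, ← mulVec_transpose, J_transpose, neg_mulVec, neg_dotProduct,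
    dotProduct_comm]

/-- If `a` and `b` are not orthogonal for the symplectic form, some symplectic matrix doubles `a`
and halves `b`. -/
theorem exists_mem_symplecticGroup_vecMul {n : ℕ} (a b : V n)
    (h : a ⬝ᵥ (J (Fin n) ℝ *ᵥ b) ≠ 0) :
    ∃ N ∈ symplecticGroup (Fin n) ℝ, a ᵥ* N = (2 : ℝ) • a ∧ b ᵥ* N = (2⁻¹ : ℝ) • b := by
  set c := a ⬝ᵥ (J (Fin n) ℝ *ᵥ b) with hc
  have hba : b ⬝ᵥ (J (Fin n) ℝ *ᵥ a) = -c := dotProduct_J_mulVec_swap b a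
  have haa : a ⬝ᵥ (J (Fin n) ℝ *ᵥ a) = 0 := by linarith [dotProduct_J_mulVec_swap a a]
  have hbb : b ⬝ᵥ (J (Fin n) ℝ *ᵥ b) = 0 := by linarith [dotProduct_J_mulVec_swap b b]
  have hJ (v : V n) : v ᵥ* J (Fin n) ℝ = -(J (Fin n) ℝ *ᵥ v) := by
    rw [← mulVec_transpose, J_transpose, neg_mulVec]
  refine ⟨1 + c⁻¹ • vecMulVec (J (Fin n) ℝ *ᵥ b) a + (2⁻¹ * c⁻¹) • vecMulVec (J (Fin n) ℝ *ᵥ a) b,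
    ?_, ?_, ?_⟩
  · rw [SymplecticGroup.mem_iff]
    simp only [transpose_add, transpose_one, transpose_smul, transpose_vecMulVec, add_mul, mul_add,
      one_mul, mul_one, smul_mul_assoc, mul_smul_comm, vecMulVec_mul, mul_vecMulVec, hJ,
      vecMulVec_neg, neg_mulVec, vecMulVec_mulVec]
    ext i j
    simp [vecMulVec_apply, dotProduct_comm (J (Fin n) ℝ *ᵥ _), haa, hbb, hba, ← hc]
    field_simp
    ring
  · simp only [vecMul_add, vecMul_one, vecMul_smul, vecMul_vecMulVec, haa, ← hc]
    ext i; simp; field_simp; ring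
  · simp only [vecMul_add, vecMul_one, vecMul_smul, vecMul_vecMulVec, hbb, hba]
    ext i; simp; field_simp; ring

/-- The full polarization of `a ↦ normalForm a d`. -/
noncomputable def polarForm {n : ℕ} (a b c d : V n) : M4 n :=
  normalForm (a + b + c) d - normalForm (a + b) d - normalForm (b + c) d - normalForm (a + c) d +
    normalForm a d + normalForm b d + normalForm c d

theorem apply_eq_sum_single {n : ℕ} (T : M4 n) (x y z w : V n) :
    T ![x, y, z, w] = ∑ r : Fin 4 → Fin n ⊕ Fin n,
      T (fun i => Pi.single (r i) 1) * (x (r 0) * y (r 1) * z (r 2) * w (r 3)) := by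
  have h : ![x, y, z, w] =
      fun i => ∑ j, (![x, y, z, w] i j) • (Pi.single j 1 : V n) := by
    funext i
    exact pi_eq_sum_univ' _
  rw [h, MultilinearMap.map_sum]
  refine Finset.sum_congr rfl fun r _ => ?_
  rw [MultilinearMap.map_smul_univ, Fin.prod_univ_four, smul_eq_mul, mul_comm]
  simp

theorem smul_eq_sum_polarForm {n : ℕ} {T : M4 n} (hT : IsN1 n T) :
    (16 : ℝ) • T = ∑ r : Fin 4 → Fin n ⊕ Fin n, T (fun i => Pi.single (r i) 1) •
      polarForm (Pi.single (r 0) 1) (Pi.single (r 1) 1) (Pi.single (r 2) 1)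
        (Pi.single (r 3) 1) := by
  obtain ⟨h1, h2, h3⟩ := hT
  refine MultilinearMap.ext fun v => ?_
  obtain ⟨x, y, z, w, rfl⟩ : ∃ x y z w : V n, v = ![x, y, z, w] :=
    ⟨v 0, v 1, v 2, v 3, by ext i; fin_cases i <;> rfl⟩
  have hsym (p q r s : V n) : T ![p, q, r, s] + T ![p, r, s, q] + T ![p, s, q, r] = 0 := by
    have := h2 p ![q, r, s]
    rw [sum_perm_fin_three fun i j k => T ![p, ![q, r, s] i, ![q, r, s] j, ![q, r, s] k]] at this
    simp only [cons_val] at this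
    linarith [h1 p q r s, h1 p r s q, h1 p s q r]
  let W (p q r s : V n) : ℝ := T ![p, q, r, s] + T ![p, r, q, s] + T ![q, p, r, s] +
    T ![q, r, p, s] + T ![r, p, q, s] + T ![r, q, p, s]
  trans 2 * W x y z w - W x z w y - W x y w z
  · simp only [W, _root_.smul_apply, smul_eq_mul]
    linarith [hsym x y z w, hsym y x z w, hsym z x y w, hsym w x y z, h1 x z w y, h1 x y w z,
      h1 x y z w, h1 y z w x, h1 y x w z, h1 y x z w, h1 z y w x, h1 z x w y, h1 z x y w,
      h1 w y z x, h1 w x z y, h1 w x y z, h3 x y z w, h3 x z y w, h3 x w y z, h3 y z x w,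
      h3 y w x z, h3 z w x y]
  · simp only [W, apply_eq_sum_single T, Finset.mul_sum, ← Finset.sum_add_distrib,
      ← Finset.sum_sub_distrib, _root_.sum_apply]
    refine Finset.sum_congr rfl fun r _ => ?_
    simp [polarForm, normalForm_apply, add_dotProduct]
    ring

/-- **There is no non-zero `Sp(2n,ℝ)`-invariant linear form on `N₁`.**
If `φ` is a real-valued map, linear on the subspace `N₁` of normal tensors of order 1,
and invariant under the symplectic group action `(M·T)(x₁,…,x₄) = T(M⁻¹x₁,…,M⁻¹x₄)`,
then `φ` vanishes identically on `N₁`. -/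
theorem no_invariant_linear_form_on_N1 (n : ℕ) (hn : 1 ≤ n)
    (φ : M4 n → ℝ)
    (hadd : ∀ T S : M4 n, IsN1 n T → IsN1 n S → φ (T + S) = φ T + φ S)
    (hsmul : ∀ (c : ℝ) (T : M4 n), IsN1 n T → φ (c • T) = c * φ T)
    (hinv : ∀ M ∈ Matrix.symplecticGroup (Fin n) ℝ, ∀ T : M4 n, IsN1 n T →
      φ (matAct n M T) = φ T) :
    ∀ T : M4 n, IsN1 n T → φ T = 0 := by
  intro T hT
  let K : Submodule ℝ (M4 n) :=
    { carrier := {S | IsN1 n S ∧ φ S = 0}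
      add_mem' := fun {S S'} hS hS' =>
        ⟨hS.1.add hS'.1, by rw [hadd _ _ hS.1 hS'.1, hS.2, hS'.2, add_zero]⟩
      zero_mem' := by
        have h0 : IsN1 n 0 := by simpa using hT.smul 0
        exact ⟨h0, by simpa using hsmul 0 0 h0⟩
      smul_mem' := fun c S hS => ⟨hS.1.smul c, by rw [hsmul c S hS.1, hS.2, mul_zero]⟩ }
  have hne (a b : V n) (h : a ⬝ᵥ (J (Fin n) ℝ *ᵥ b) ≠ 0) : normalForm a b ∈ K := by
    obtain ⟨N, hN, ha, hb⟩ := exists_mem_symplecticGroup_vecMul a b h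
    have hN' : N⁻¹ ∈ symplecticGroup (Fin n) ℝ := by
      have := (⟨N, hN⟩ : symplecticGroup (Fin n) ℝ)⁻¹.2
      rwa [SymplecticGroup.coe_inv'] at this
    have := hinv _ hN' _ (isN1_normalForm a b)
    rw [matAct_normalForm, nonsing_inv_nonsing_inv _ (SymplecticGroup.symplectic_det hN), ha, hb,
      normalForm_smul_smul, hsmul _ _ (isN1_normalForm a b)] at this
    exact ⟨isN1_normalForm a b, by linarith⟩
  have hall (a b : V n) : normalForm a b ∈ K := by
    by_cases ha : a = 0
    · have : normalForm a b = 0 := by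
        refine MultilinearMap.ext fun v => ?_
        simp [normalForm_apply, ha]
      rw [this]
      exact K.zero_mem
    by_cases hab : a ⬝ᵥ (J (Fin n) ℝ *ᵥ b) = 0
    · have haJ : a ⬝ᵥ (J (Fin n) ℝ *ᵥ (J (Fin n) ℝ *ᵥ a)) ≠ 0 := by
        rw [mulVec_mulVec, J_squared, neg_mulVec, one_mulVec, dotProduct_neg, neg_ne_zero]
        exact dotProduct_self_eq_zero.not.mpr ha
      have h1 := hne a (b + J (Fin n) ℝ *ᵥ a) (by rwa [mulVec_add, dotProduct_add, hab, zero_add])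
      rw [normalForm_add_right] at h1
      exact (K.add_mem_iff_left (hne _ _ haJ)).mp h1
    · exact hne a b hab
  have hpol (a b c d : V n) : polarForm a b c d ∈ K :=
    K.add_mem (K.add_mem (K.add_mem (K.sub_mem (K.sub_mem (K.sub_mem (hall _ _) (hall _ _))
      (hall _ _)) (hall _ _)) (hall _ _)) (hall _ _)) (hall _ _)
  have h16 : (16 : ℝ) • T ∈ K := by
    rw [smul_eq_sum_polarForm hT]
    exact K.sum_mem fun r _ => K.smul_mem _ (hpol _ _ _ _)
  exact ((K.smul_mem_iff (by norm_num)).mp h16).2
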